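/- Let F be a field of characteristic 2, n ≥ 4, and let χ be a quadratic form on Fⁿ which is non-singular and has Witt index at least 2. Then the F-linear span of {x·yᵀ − y·xᵀ : x, y ∈ Fⁿ linearly independent and span{x,y} totally singular for χ} has dimension exactly n(n−1)/2 − 1; that is, it is a hyperplane of the space of alternating n×n matrices {A : Aᵀ = −A and all diagonal entries of A are 0}. -/

import Mathlib

open Matrix

section WittIndexTwo

variable {F V : Type*} [Field F] [AddCommGroup V] [Module F V]

/-- If no vector `a - t • b` lies in the left radical of `B`, then some vector is
orthogonal to `b` and pairs to `1` with `a`. -/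
theorem exists_pairing_one_zero (B : LinearMap.BilinForm F V) (a b : V)
    (h : ∀ t : F, ∃ z, B (a - t • b) z ≠ 0) : ∃ z, B a z = 1 ∧ B b z = 0 := by
  by_contra! hcon
  have hker : LinearMap.ker (B b) ≤ LinearMap.ker (B a) := by
    intro z hz
    by_contra hne
    rw [LinearMap.mem_ker] at hz hne
    exact hcon ((B a z)⁻¹ • z) (by simp [hne]) (by simp [hz])
  obtain ⟨t, ht⟩ : ∃ t : F, B a = t • B b := by
    have hmem : B a ∈ Submodule.span F (Set.range fun _ : Unit => B b) :=
      mem_span_of_iInf_ker_le_ker (by simpa using hker)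
    obtain ⟨t, ht⟩ := Submodule.mem_span_singleton.1 (by simpa using hmem)
    exact ⟨t, ht.symm⟩
  obtain ⟨z, hz⟩ := h t
  exact hz (by simp [ht])

/-- In a non-singular quadratic space, a totally singular plane with basis `a, b` is completed to
an orthogonal sum of two hyperbolic planes. -/
theorem exists_hyperbolic_completion [CharP F 2] (χ : QuadraticForm F V)
    (hns : ∀ w : V, w ≠ 0 → (∀ z, χ.polarBilin w z = 0) → χ w ≠ 0)
    {a b : V} (hlin : LinearIndependent F ![a, b])
    (hsing : ∀ v ∈ Submodule.span F {a, b}, χ v = 0) :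
    ∃ c d : V, χ c = 0 ∧ χ d = 0 ∧ χ.polarBilin a c = 1 ∧ χ.polarBilin b d = 1 ∧
      χ.polarBilin a d = 0 ∧ χ.polarBilin b c = 0 ∧ χ.polarBilin c d = 0 := by
  have hab : ∀ s t : F, χ (s • a + t • b) = 0 := fun s t =>
    hsing _ (Submodule.mem_span_pair.2 ⟨s, t, rfl⟩)
  have hnotrad : ∀ s t : F, (s ≠ 0 ∨ t ≠ 0) → ∃ z, χ.polarBilin (s • a + t • b) z ≠ 0 := by
    intro s t hst
    by_contra! hcon
    refine hns _ (fun h0 => ?_) hcon (hab s t)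
    have := LinearIndependent.pair_iff.1 hlin s t h0
    tauto
  have hadd : ∀ x y, χ (x + y) = χ x + χ y + χ.polarBilin x y := fun x y => by
    simp [QuadraticMap.polar]
  have hsymm : ∀ x y, χ.polarBilin x y = χ.polarBilin y x := fun x y => by
    simp [QuadraticMap.polar_comm]
  have hself : ∀ x, χ.polarBilin x x = 0 := fun x => by
    simp [CharTwo.two_eq_zero]
  have ha : χ a = 0 := by simpa using hab 1 0
  have hb : χ b = 0 := by simpa using hab 0 1
  have hφab : χ.polarBilin a b = 0 := by
    have := hadd a b
    have h11 := hab 1 1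
    simp only [one_smul] at h11
    rw [h11, ha, hb] at this
    simpa using this.symm
  have hfix : ∀ e z, χ e = 0 → χ.polarBilin e z = 1 → χ (z + (-χ z) • e) = 0 := by
    intro e z he hez
    rw [hadd, QuadraticMap.map_smul, he, map_smul, hsymm z e, hez]
    simp
  obtain ⟨z, hz1, hz2⟩ := exists_pairing_one_zero χ.polarBilin a b fun t => by
    simpa [sub_eq_add_neg] using hnotrad 1 (-t) (by simp)
  obtain ⟨y, hy1, hy2⟩ := exists_pairing_one_zero χ.polarBilin b a fun t => by
    simpa [sub_eq_add_neg, add_comm] using hnotrad (-t) 1 (by simp)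
  set φ := χ.polarBilin
  set c := z + (-χ z) • a with hc
  have hac : φ a c = 1 := by rw [hc, map_add, map_smul, hself, hz1]; simp
  have hbc : φ b c = 0 := by rw [hc, map_add, map_smul, hsymm b a, hφab, hz2]; simp
  set y' := y + (-φ c y) • a with hy'
  have hby' : φ b y' = 1 := by rw [hy', map_add, map_smul, hsymm b a, hφab, hy1]; simp
  have hay' : φ a y' = 0 := by rw [hy', map_add, map_smul, hself, hy2]; simp
  have hcy' : φ c y' = 0 := by rw [hy', map_add, map_smul, hsymm c a, hac]; simp
  refine ⟨c, y' + (-χ y') • b, hfix a z ha hz1, hfix b y' hb hby', hac, ?_, ?_, hbc, ?_⟩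
  · rw [map_add, map_smul, hself, hby']; simp
  · rw [map_add, map_smul, hφab, hay']; simp
  · rw [map_add, map_smul, hsymm c b, hbc, hcy']; simp

/-- In characteristic 2, on a non-singular quadratic space of Witt index at least 2, an alternating
form vanishing on all totally singular planes is a multiple of the polar form. -/
theorem eq_smul_polarBilin_of_vanishing [CharP F 2] (χ : QuadraticForm F V)
    (hns : ∀ w : V, w ≠ 0 → (∀ z, χ.polarBilin w z = 0) → χ w ≠ 0)
    {a b : V} (hlin : LinearIndependent F ![a, b])
    (hsing : ∀ v ∈ Submodule.span F {a, b}, χ v = 0)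
    (B : LinearMap.BilinForm F V) (hB : B.IsAlt)
    (hvan : ∀ x y, χ x = 0 → χ y = 0 → χ.polarBilin x y = 0 → B x y = 0) :
    ∃ t : F, B = t • χ.polarBilin := by
  obtain ⟨c, d, hc, hd, hac, hbd, had, hbc, hcd⟩ := exists_hyperbolic_completion χ hns hlin hsing
  have hadd : ∀ x y, χ (x + y) = χ x + χ y + χ.polarBilin x y := fun x y => by
    simp [QuadraticMap.polar]
  have hsymm : ∀ x y, χ.polarBilin x y = χ.polarBilin y x := fun x y => by
    simp [QuadraticMap.polar_comm]
  have hself : ∀ x, χ.polarBilin x x = 0 := fun x => by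
    simp [CharTwo.two_eq_zero]
  have ha : χ a = 0 := hsing _ (Submodule.subset_span (by simp))
  have hb : χ b = 0 := hsing _ (Submodule.subset_span (by simp))
  have hab : χ.polarBilin a b = 0 := by
    have h := hadd a b
    rw [hsing (a + b) (Submodule.mem_span_pair.2 ⟨1, 1, by simp⟩), ha, hb] at h
    simpa using h.symm
  have hBself : ∀ x, B x x = 0 := hB
  have hBsymm : ∀ x y, B x y = B y x := fun x y => by
    rw [← hB.neg_eq x y, CharTwo.neg_eq]
  set φ := χ.polarBilin
  have hca : φ c a = 1 := by rw [hsymm, hac]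
  have hdb : φ d b = 1 := by rw [hsymm, hbd]
  have hda : φ d a = 0 := by rw [hsymm, had]
  have hcb : φ c b = 0 := by rw [hsymm, hbc]
  have hdc : φ d c = 0 := by rw [hsymm, hcd]
  have hba : φ b a = 0 := by rw [hsymm, hab]
  have hBab := hvan a b ha hb hab
  have hBad := hvan a d ha hd had
  have hBbc := hvan b c hb hc hbc
  have hBcd := hvan c d hc hd hcd
  have hBba := hvan b a hb ha hba
  have hBda := hvan d a hd ha hda
  have hBcb := hvan c b hc hb hcb
  have hBdc := hvan d c hd hc hdc
  have hBbd : B b d = B a c := by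
    have h := hvan (a + b) (c + d) (by simp [hadd, ha, hb, hab])
      (by simp [hadd, hc, hd, hcd])
      (by simp only [map_add, LinearMap.add_apply, hac, hbd, had, hbc]
          simp [CharTwo.add_self_eq_zero])
    simp only [map_add, LinearMap.add_apply, hBad, hBbc, zero_add, add_zero] at h
    exact (CharTwo.add_eq_zero.1 h).symm
  have hperp : ∀ e f g w, χ e = 0 → χ f = 0 → χ g = 0 → φ e f = 0 → φ e g = 0 → φ f g = 1 →
      φ e w = 0 → φ f w = 0 → φ g w = 0 → B e w = 0 := by
    intro e f g w he hf hg hef heg hfg hew hfw hgw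
    have h := hvan e (f + (χ w • g + w)) he
      (by rw [hadd, hadd, QuadraticMap.map_smul, map_add, map_smul, map_smul,
            LinearMap.smul_apply, hf, hg, hfg, hfw]
          simp [hgw, CharTwo.add_self_eq_zero])
      (by rw [map_add, map_add, map_smul, hef, heg, hew]; simp)
    rwa [map_add, map_add, map_smul, hvan e f he hf hef, hvan e g he hg heg, smul_zero,
      zero_add, zero_add] at h
  have hWW : ∀ w w', φ a w = 0 → φ b w = 0 → φ c w = 0 → φ d w = 0 →
      φ a w' = 0 → φ b w' = 0 → φ c w' = 0 → φ d w' = 0 → B w w' = B a c * φ w w' := by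
    intro w w' haw hbw hcw hdw haw' hbw' hcw' hdw'
    have hBaw' := hperp a b d w' ha hb hd hab had hbd haw' hbw' hdw'
    have hBcw' := hperp c b d w' hc hb hd hcb hcd hbd hcw' hbw' hdw'
    have hBbw := hperp b a c w hb ha hc hba hbc hac hbw haw hcw
    have hBcw := hperp c b d w hc hb hd hcb hcd hbd hcw hbw hdw
    have hBdw := hperp d a c w hd ha hc hda hdc hac hdw haw hcw
    rw [hBsymm] at hBbw hBcw hBdw
    rw [hsymm] at haw hbw hcw hdw
    have h := hvan (w + (a + χ w • c)) (w' + (φ w w' • c + (b + χ w' • d)))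
      (by simp only [hadd, QuadraticMap.map_smul, map_add, map_smul, haw, hcw, ha, hc, hac]
          simp [CharTwo.add_self_eq_zero])
      (by rw [hsymm] at hbw' hcw' hdw'
          simp only [hadd, QuadraticMap.map_smul, map_add, map_smul, LinearMap.smul_apply,
            hbw', hcw', hdw', hb, hc, hd, hbd, hcb, hcd]
          simp [CharTwo.add_self_eq_zero])
      (by simp only [map_add, map_smul, LinearMap.add_apply, LinearMap.smul_apply,
            hbw, hcw, hdw, haw', hcw', hac, hab, had, hself, hcb, hcd]
          simp [CharTwo.add_self_eq_zero])
    simp only [map_add, map_smul, LinearMap.add_apply, LinearMap.smul_apply, hBbw, hBcw, hBdw,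
      hBaw', hBcw', hBab, hBad, hBself, hBcb, hBcd, smul_eq_mul,
      mul_zero, add_zero, zero_add] at h
    rw [CharTwo.add_eq_zero.1 h, mul_comm]
  have hdecomp : ∀ v, ∃ p q r s : F, ∃ w, φ a w = 0 ∧ φ b w = 0 ∧ φ c w = 0 ∧ φ d w = 0 ∧
      v = p • a + q • b + r • c + s • d + w := by
    intro v
    refine ⟨φ c v, φ d v, φ a v, φ b v,
      v - (φ c v • a + φ d v • b + φ a v • c + φ b v • d), ?_, ?_, ?_, ?_, by abel⟩ <;>
    simp only [map_sub, map_add, map_smul, hself, hab, hac, had, hba, hbc, hbd, hca, hcb, hcd,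
      hda, hdb, hdc] <;> simp
  refine ⟨B a c, LinearMap.ext₂ fun x y => ?_⟩
  obtain ⟨p, q, r, s, w, haw, hbw, hcw, hdw, rfl⟩ := hdecomp x
  obtain ⟨p', q', r', s', w', haw', hbw', hcw', hdw', rfl⟩ := hdecomp y
  have hBaw' := hperp a b d w' ha hb hd hab had hbd haw' hbw' hdw'
  have hBbw' := hperp b a c w' hb ha hc hba hbc hac hbw' haw' hcw'
  have hBcw' := hperp c b d w' hc hb hd hcb hcd hbd hcw' hbw' hdw'
  have hBdw' := hperp d a c w' hd ha hc hda hdc hac hdw' haw' hcw'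
  have hBaw := hperp a b d w ha hb hd hab had hbd haw hbw hdw
  have hBbw := hperp b a c w hb ha hc hba hbc hac hbw haw hcw
  have hBcw := hperp c b d w hc hb hd hcb hcd hbd hcw hbw hdw
  have hBdw := hperp d a c w hd ha hc hda hdc hac hdw haw hcw
  have hBw := hWW w w' haw hbw hcw hdw haw' hbw' hcw' hdw'
  rw [hBsymm] at hBaw hBbw hBcw hBdw
  rw [hsymm] at haw hbw hcw hdw
  have hBca : B c a = B a c := hBsymm c a
  have hBdb : B d b = B a c := by rw [hBsymm, hBbd]
  simp only [map_add, map_smul, LinearMap.add_apply, LinearMap.smul_apply, smul_eq_mul,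
    hBaw, hBbw, hBcw, hBdw, hBaw', hBbw', hBcw', hBdw', haw, hbw, hcw, hdw, haw', hbw', hcw', hdw',
    hBself, hBab, hBad, hBba, hBbc, hBbd, hBca, hBcb, hBcd, hBda, hBdb, hBdc, hBw,
    hself, hab, hac, had, hba, hbc, hbd, hca, hcb, hcd, hda, hdb, hdc]
  ring

end WittIndexTwo

section Wedge

/-- Pairs `i < j` of indices, labelling the entries above the diagonal. -/
abbrev UpperPair (n : ℕ) : Type := {p : Fin n × Fin n // p.1 < p.2}

theorem card_upperPair (n : ℕ) : Fintype.card (UpperPair n) = n * (n - 1) / 2 := by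
  rw [Fintype.card_subtype, ← Finset.sum_range_id, ← Fin.sum_univ_eq_sum_range (fun i => i) n,
    Finset.card_filter, Fintype.sum_prod_type_right]
  refine Finset.sum_congr rfl fun j _ => ?_
  rw [← Finset.card_filter, ← Fin.card_Iio j]
  congr 1
  ext i
  simp

variable (F : Type*) [Field F] (n : ℕ)

/-- The `2 × 2` minors of a pair of vectors. -/
def wedge : (Fin n → F) →ₗ[F] (Fin n → F) →ₗ[F] (UpperPair n → F) :=
  LinearMap.mk₂ F (fun x y p => x p.1.1 * y p.1.2 - y p.1.1 * x p.1.2)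
    (fun x x' y => by ext p; simp; ring) (fun t x y => by ext p; simp; ring)
    (fun x y y' => by ext p; simp; ring) (fun t x y => by ext p; simp; ring)

variable {F n}

theorem wedge_apply (x y : Fin n → F) (p : UpperPair n) :
    wedge F n x y p = x p.1.1 * y p.1.2 - y p.1.1 * x p.1.2 := rfl

theorem wedge_self (x : Fin n → F) : wedge F n x x = 0 := by
  ext p
  simp [wedge_apply]

theorem wedge_single (p : UpperPair n) :
    wedge F n (Pi.single p.1.1 1) (Pi.single p.1.2 1) = Pi.single p 1 := by
  obtain ⟨⟨i, j⟩, hij⟩ := p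
  ext ⟨⟨k, l⟩, hkl⟩
  simp only [wedge_apply, Pi.single_apply, Subtype.mk.injEq, Prod.mk.injEq]
  simp only at hij hkl
  by_cases h1 : k = i <;> by_cases h2 : l = j <;> simp [h1, h2] <;> omega

variable (F n) in
/-- The alternating matrix with prescribed entries above the diagonal. -/
def altMatrix : (UpperPair n → F) →ₗ[F] Matrix (Fin n) (Fin n) F where
  toFun v := Matrix.of fun i j =>
    if h : i < j then v ⟨(i, j), h⟩ else if h : j < i then -v ⟨(j, i), h⟩ else 0
  map_add' u v := by
    ext i j
    simp only [Matrix.of_apply, Matrix.add_apply, Pi.add_apply]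
    split_ifs <;> simp [add_comm]
  map_smul' t v := by
    ext i j
    simp only [Matrix.of_apply, Matrix.smul_apply, Pi.smul_apply]
    split_ifs <;> simp

theorem altMatrix_apply (v : UpperPair n → F) (i j : Fin n) :
    altMatrix F n v i j =
      if h : i < j then v ⟨(i, j), h⟩ else if h : j < i then -v ⟨(j, i), h⟩ else 0 := rfl

theorem altMatrix_injective : Function.Injective (altMatrix F n) := by
  intro u v h
  ext ⟨⟨i, j⟩, hij⟩
  have hij' : i < j := hij
  simpa [altMatrix_apply, hij'] using congrFun (congrFun h i) j

theorem altMatrix_wedge (x y : Fin n → F) :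
    altMatrix F n (wedge F n x y) = vecMulVec x y - vecMulVec y x := by
  ext i j
  simp only [altMatrix_apply, wedge_apply, Matrix.sub_apply, vecMulVec_apply]
  split_ifs with h1 h2
  · rfl
  · ring
  · obtain rfl : i = j := le_antisymm (not_lt.1 h2) (not_lt.1 h1)
    ring

/-- Every alternating bilinear form factors through `wedge`. -/
theorem exists_dual_compr₂_wedge (B : LinearMap.BilinForm F (Fin n → F)) (hB : B.IsAlt) :
    ∃ f : Module.Dual F (UpperPair n → F), ∀ x y, f (wedge F n x y) = B x y := by
  let f : Module.Dual F (UpperPair n → F) :=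
    Fintype.linearCombination F fun p => B (Pi.single p.1.1 1) (Pi.single p.1.2 1)
  have hf : ∀ i j, i < j → f (wedge F n (Pi.single i 1) (Pi.single j 1)) =
      B (Pi.single i 1) (Pi.single j 1) := by
    intro i j hij
    rw [wedge_single ⟨(i, j), hij⟩]
    simp [f]
  have halt : ((wedge F n).compr₂ f).IsAlt := fun x => by simp [wedge_self]
  have heq : (wedge F n).compr₂ f = B := by
    refine LinearMap.ext_basis (Pi.basisFun F (Fin n)) (Pi.basisFun F (Fin n)) fun i j => ?_
    simp only [Pi.basisFun_apply]
    rcases lt_trichotomy i j with h | rfl | h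
    · exact hf i j h
    · rw [halt, hB]
    · rw [← halt.neg, ← hB.neg_eq]
      exact congrArg Neg.neg (hf j i h)
  exact ⟨f, fun x y => by rw [← heq, LinearMap.compr₂_apply]⟩

end Wedge

/-- Theorems 3.6 and 3.9 combined: in characteristic 2, for a non-singular
quadratic form `χ` of Witt index at least 2, the span of the matrices
`xyᵀ − yxᵀ` over totally singular 2-spaces is a hyperplane of the space of
alternating `n×n` matrices, i.e. has dimension `n(n−1)/2 − 1`. -/
theorem stmt_9 (F : Type*) [Field F] [CharP F 2] (n : ℕ) (hn : 4 ≤ n)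
    (χ : QuadraticForm F (Fin n → F))
    (hns : ∀ w : Fin n → F, w ≠ 0 →
      (∀ z : Fin n → F, QuadraticMap.polar χ w z = 0) → χ w ≠ 0)
    (hWitt : ∃ a b : Fin n → F, LinearIndependent F ![a, b] ∧
      ∀ v ∈ Submodule.span F {a, b}, χ v = 0) :
    Module.finrank F (Submodule.span F
      {A : Matrix (Fin n) (Fin n) F | ∃ x y : Fin n → F,
        LinearIndependent F ![x, y] ∧
        (∀ v ∈ Submodule.span F {x, y}, χ v = 0) ∧
        A = vecMulVec x y - vecMulVec y x}) = n * (n - 1) / 2 - 1 := by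
  obtain ⟨a, b, hlin, hsing⟩ := hWitt
  have hsing' : ∀ {x y : Fin n → F}, (∀ v ∈ Submodule.span F {x, y}, χ v = 0) ↔
      χ x = 0 ∧ χ y = 0 ∧ χ.polarBilin x y = 0 := by
    intro x y
    constructor
    · intro h
      have hx : χ x = 0 := h x (Submodule.subset_span (by simp))
      have hy : χ y = 0 := h y (Submodule.subset_span (by simp))
      have hxy := h (x + y) (Submodule.mem_span_pair.2 ⟨1, 1, by simp⟩)
      exact ⟨hx, hy, by simp [QuadraticMap.polar, hx, hy, hxy]⟩
    · rintro ⟨hx, hy, hxy⟩ v hv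
      obtain ⟨s, t, rfl⟩ := Submodule.mem_span_pair.1 hv
      rw [QuadraticMap.polarBilin_apply_apply] at hxy
      rw [QuadraticMap.map_add χ, QuadraticMap.map_smul, QuadraticMap.map_smul,
        QuadraticMap.polar_smul_left, QuadraticMap.polar_smul_right, hx, hy, hxy]
      simp
  set T : Set (UpperPair n → F) := {u | ∃ x y : Fin n → F, LinearIndependent F ![x, y] ∧
    (∀ v ∈ Submodule.span F {x, y}, χ v = 0) ∧ u = wedge F n x y} with hT
  have himage : {A : Matrix (Fin n) (Fin n) F | ∃ x y : Fin n → F,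
      LinearIndependent F ![x, y] ∧ (∀ v ∈ Submodule.span F {x, y}, χ v = 0) ∧
      A = vecMulVec x y - vecMulVec y x} = altMatrix F n '' T := by
    ext A
    constructor
    · rintro ⟨x, y, hxy, hs, rfl⟩
      exact ⟨_, ⟨x, y, hxy, hs, rfl⟩, altMatrix_wedge x y⟩
    · rintro ⟨_, ⟨x, y, hxy, hs, rfl⟩, rfl⟩
      exact ⟨x, y, hxy, hs, altMatrix_wedge x y⟩
  have hφ : χ.polarBilin.IsAlt := fun x => by simp [CharTwo.two_eq_zero]
  obtain ⟨f, hf⟩ := exists_dual_compr₂_wedge χ.polarBilin hφ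
  have hf0 : f ≠ 0 := by
    rintro rfl
    have ha0 : a ≠ 0 := by simpa using hlin.ne_zero 0
    refine hns a ha0 (fun z => ?_) (hsing'.1 hsing).1
    simpa using (hf a z).symm
  have hann : (Submodule.span F T).dualAnnihilator = F ∙ f := by
    ext g
    rw [Submodule.mem_span_singleton, Submodule.mem_dualAnnihilator]
    constructor
    · intro hg
      have halt : ((wedge F n).compr₂ g).IsAlt := fun x => by simp [wedge_self]
      obtain ⟨t, ht⟩ := eq_smul_polarBilin_of_vanishing χ hns hlin hsing _ halt
        (fun x y hx hy hxy => by
          by_cases hli : LinearIndependent F ![x, y]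
          · exact hg _ (Submodule.subset_span ⟨x, y, hli, hsing'.2 ⟨hx, hy, hxy⟩, rfl⟩)
          · by_cases hx0 : x = 0
            · simp [hx0]
            · rw [LinearIndependent.pair_iff' hx0] at hli
              push Not at hli
              obtain ⟨t, rfl⟩ := hli
              rw [map_smul, halt, smul_zero])
      refine ⟨t, LinearMap.pi_ext' fun p => LinearMap.ext_ring ?_⟩
      have h := LinearMap.congr_fun₂ ht (Pi.single p.1.1 1) (Pi.single p.1.2 1)
      rw [LinearMap.smul_apply, LinearMap.smul_apply, ← hf, LinearMap.compr₂_apply,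
        wedge_single] at h
      exact h.symm
    · rintro ⟨t, rfl⟩ u hu
      have hle : Submodule.span F T ≤ LinearMap.ker f := by
        rw [Submodule.span_le]
        rintro _ ⟨x, y, -, hs, rfl⟩
        exact (hf x y).trans (hsing'.1 hs).2.2
      rw [LinearMap.smul_apply, LinearMap.mem_ker.1 (hle hu), smul_zero]
  have hdim := Subspace.finrank_add_finrank_dualAnnihilator_eq (Submodule.span F T)
  rw [hann, finrank_span_singleton hf0, Module.finrank_fintype_fun_eq_card, card_upperPair] at hdim
  rw [himage, ← Submodule.map_span,
    ← (Submodule.equivMapOfInjective _ altMatrix_injective (Submodule.span F T)).finrank_eq]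
  omega
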